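/- arXiv:1304.4813 — 2 statements merged into one kernel-verified Lean document; each statement's English description precedes it below -/
import Mathlib

section
/- For every integer n ≥ 1 one has the identity (in ℚ): Σ_{k=1}^{n} S′_{n,k}(1) = −(1/4)·B_{n+2} + (n/2 + 1/4)·B_{n+1} + (−n/2 + 1/4)·B_n, where S′_{n,k} denotes the formal derivative of the q-Stirling polynomial S_{n,k}(q). Consequently, the average value over Π_n of any set-partition statistic whose generating polynomial on each Π_n^k is S_{n,k}(q) equals the right-hand side divided by B_n. -/
open scoped Classical

def seg (n : ℕ) : Finset ℕ := Finset.Icc 1 n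

def IsPartition (P : Finset (Finset ℕ)) (S : Finset ℕ) : Prop :=
  ∅ ∉ P ∧ (∀ B ∈ P, ∀ C ∈ P, B ≠ C → Disjoint B C) ∧ P.biUnion id = S

noncomputable def partitions (n : ℕ) : Finset (Finset (Finset ℕ)) :=
  ((seg n).powerset.powerset).filter fun P => IsPartition P (seg n)

noncomputable def partitionsK (n k : ℕ) : Finset (Finset (Finset ℕ)) :=
  (partitions n).filter fun P => P.card = k

noncomputable def bell (n : ℕ) : ℕ := (partitions n).card

noncomputable def stirling (n k : ℕ) : ℕ := (partitionsK n k).card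

/-- `(i, j)` is an edge of the set partition `P`. -/
def IsEdge (P : Finset (Finset ℕ)) (i j : ℕ) : Prop :=
  i < j ∧ ∃ B ∈ P, i ∈ B ∧ j ∈ B ∧ ∀ p ∈ B, ¬(i < p ∧ p < j)

/-- `crol P`: number of linear crossings. -/
noncomputable def crol (P : Finset (Finset ℕ)) : ℕ :=
  Nat.card {e : (ℕ × ℕ) × ℕ × ℕ //
    IsEdge P e.1.1 e.1.2 ∧ IsEdge P e.2.1 e.2.2 ∧
      e.1.1 < e.2.1 ∧ e.2.1 < e.1.2 ∧ e.1.2 < e.2.2}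

/-- `(i, j)` is a circular edge of `P`. -/
def IsCircEdge (P : Finset (Finset ℕ)) (i j : ℕ) : Prop :=
  IsEdge P i j ∨
    ∃ B ∈ P, ∃ h : B.Nonempty, 2 ≤ B.card ∧ i = B.min' h ∧ j = B.max' h

/-- `croc P`: number of circular crossings. -/
noncomputable def croc (P : Finset (Finset ℕ)) : ℕ :=
  Nat.card {e : (ℕ × ℕ) × ℕ × ℕ //
    IsCircEdge P e.1.1 e.1.2 ∧ IsCircEdge P e.2.1 e.2.2 ∧
      e.1.1 < e.2.1 ∧ e.2.1 < e.1.2 ∧ e.1.2 < e.2.2}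

/-- Two blocks overlap: `min B < min B' < max B < max B'`. -/
def Overlap (B B' : Finset ℕ) : Prop :=
  ∃ (h : B.Nonempty) (h' : B'.Nonempty),
    B.min' h < B'.min' h' ∧ B'.min' h' < B.max' h ∧ B.max' h < B'.max' h'

/-- `ov P`: number of (unordered) pairs of blocks of `P` that overlap. -/
noncomputable def ov (P : Finset (Finset ℕ)) : ℕ :=
  Nat.card {p : Finset ℕ × Finset ℕ // p.1 ∈ P ∧ p.2 ∈ P ∧ Overlap p.1 p.2}

/-- Two blocks embrace: `min B < min B' ≤ max B' < max B`. -/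
def Embrace (B B' : Finset ℕ) : Prop :=
  ∃ (h : B.Nonempty) (h' : B'.Nonempty),
    B.min' h < B'.min' h' ∧ B'.min' h' ≤ B'.max' h' ∧ B'.max' h' < B.max' h

noncomputable def emb (P : Finset (Finset ℕ)) : ℕ :=
  Nat.card {p : Finset ℕ × Finset ℕ // p.1 ∈ P ∧ p.2 ∈ P ∧ Embrace p.1 p.2}

/-- The block of `P` containing `i`. -/
noncomputable def blockOf (P : Finset (Finset ℕ)) (i : ℕ) : Finset ℕ :=
  (P.filter fun B => i ∈ B).biUnion id

/-- The restricted growth function of `P`: `rgf P i = j` iff `i` lies in the `j`-th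
block of `P`, the blocks being ordered by increasing minima. -/
noncomputable def rgf (P : Finset (Finset ℕ)) (i : ℕ) : ℕ :=
  (P.filter fun B => B.min ≤ (blockOf P i).min).card

/-- A 2-pattern: a word on `{1,2}` containing both letters. -/
def TwoPattern {r : ℕ} (σ : Fin r → ℕ) : Prop :=
  (∀ t, σ t = 1 ∨ σ t = 2) ∧ (∃ t, σ t = 1) ∧ (∃ t, σ t = 2)

/-- `occ n σ P`: number of occurrences of the 2-pattern `σ` in the partition `P` of `[n]`. -/
noncomputable def occ (n : ℕ) {r : ℕ} (σ : Fin r → ℕ) (P : Finset (Finset ℕ)) : ℕ :=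
  Nat.card {i : Fin r → ℕ // StrictMono i ∧ (∀ t, i t ∈ seg n) ∧
    ∃ a b : ℕ, a < b ∧
      ∀ t, (σ t = 1 → rgf P (i t) = a) ∧ (σ t = 2 → rgf P (i t) = b)}

/-- Carlitz `q`-Stirling polynomials. -/
noncomputable def qS : ℕ → ℕ → Polynomial ℚ
  | 0, 0 => 1
  | 0, _ + 1 => 0
  | _ + 1, 0 => 0
  | n + 1, k + 1 =>
      Polynomial.X ^ k * qS n k +
        (∑ i ∈ Finset.range (k + 1), Polynomial.X ^ i) * qS n (k + 1)

/-- Standardization: the order preserving bijection `S → [|S|]`. -/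
def stdMap (S : Finset ℕ) (a : ℕ) : ℕ := (S.filter fun x => x ≤ a).card

/-- The standardized 2-block partition obtained from two blocks `A, B`. -/
def stdPair (A B : Finset ℕ) : Finset (Finset ℕ) :=
  {A.image (stdMap (A ∪ B)), B.image (stdMap (A ∪ B))}

theorem isPartition_iff {P : Finset (Finset ℕ)} {S : Finset ℕ} :
    IsPartition P S ↔ ∅ ∉ P ∧ (∀ B ∈ P, ∀ C ∈ P, ∀ x, x ∈ B → x ∈ C → B = C) ∧
      ∀ x, x ∈ S ↔ ∃ B ∈ P, x ∈ B := by
  unfold IsPartition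
  refine and_congr_right fun _ => and_congr ?_ ?_
  · refine forall₄_congr fun B _ C _ => ?_
    rw [Finset.disjoint_left]
    grind
  · rw [Finset.ext_iff]
    refine forall_congr' fun x => ?_
    simp only [Finset.mem_biUnion, id]
    exact Iff.comm

theorem mem_partitions {n : ℕ} {P : Finset (Finset ℕ)} :
    P ∈ partitions n ↔ IsPartition P (seg n) := by
  simp only [partitions, Finset.mem_filter, Finset.mem_powerset, and_iff_right_iff_imp]
  intro h B hB
  rw [Finset.mem_powerset, ← h.2.2]
  exact Finset.subset_biUnion_of_mem id hB

theorem mem_partitionsK {n k : ℕ} {P : Finset (Finset ℕ)} :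
    P ∈ partitionsK n k ↔ IsPartition P (seg n) ∧ P.card = k := by
  rw [partitionsK, Finset.mem_filter, mem_partitions]

theorem seg_succ (n : ℕ) : seg (n + 1) = insert (n + 1) (seg n) := by
  ext x
  simp only [seg, Finset.mem_Icc, Finset.mem_insert]
  omega

theorem succ_notMem_seg (n : ℕ) : n + 1 ∉ seg n := by
  simp [seg]

theorem IsPartition.notMem {P : Finset (Finset ℕ)} {S B : Finset ℕ} {a : ℕ}
    (h : IsPartition P S) (ha : a ∉ S) (hB : B ∈ P) : a ∉ B :=
  fun haB => ha ((isPartition_iff.1 h).2.2 a |>.2 ⟨B, hB, haB⟩)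

theorem IsPartition.insert_singleton {P : Finset (Finset ℕ)} {S : Finset ℕ} {a : ℕ}
    (h : IsPartition P S) (ha : a ∉ S) : IsPartition (insert {a} P) (insert a S) := by
  have hn := fun B hB => h.notMem (B := B) ha hB
  rw [isPartition_iff] at h ⊢
  obtain ⟨h0, h1, h2⟩ := h
  refine ⟨?_, ?_, ?_⟩
  · simp [h0, (Finset.singleton_ne_empty a).symm]
  · intro B hB C hC x hxB hxC
    rw [Finset.mem_insert] at hB hC
    rcases hB with rfl | hB <;> rcases hC with rfl | hC
    · rfl
    · rw [Finset.mem_singleton] at hxB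
      exact absurd (hxB ▸ hxC) (hn C hC)
    · rw [Finset.mem_singleton] at hxC
      exact absurd (hxC ▸ hxB) (hn B hB)
    · exact h1 B hB C hC x hxB hxC
  · intro x
    simp [h2]

theorem IsPartition.erase_singleton {P : Finset (Finset ℕ)} {S : Finset ℕ} {a : ℕ}
    (h : IsPartition P (insert a S)) (ha : a ∉ S) (haP : {a} ∈ P) :
    IsPartition (P.erase {a}) S := by
  rw [isPartition_iff] at h ⊢
  obtain ⟨h0, h1, h2⟩ := h
  refine ⟨fun h => h0 (Finset.mem_of_mem_erase h), ?_, ?_⟩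
  · intro B hB C hC
    exact h1 B (Finset.mem_of_mem_erase hB) C (Finset.mem_of_mem_erase hC)
  · intro x
    constructor
    · intro hx
      obtain ⟨B, hB, hxB⟩ := (h2 x).1 (Finset.mem_insert_of_mem hx)
      refine ⟨B, Finset.mem_erase.2 ⟨?_, hB⟩, hxB⟩
      rintro rfl
      exact ha (Finset.mem_singleton.1 hxB ▸ hx)
    · rintro ⟨B, hB, hxB⟩
      obtain ⟨hne, hBP⟩ := Finset.mem_erase.1 hB
      refine Finset.mem_of_mem_insert_of_ne ((h2 x).2 ⟨B, hBP, hxB⟩) ?_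
      rintro rfl
      exact hne (h1 B hBP _ haP x hxB (Finset.mem_singleton_self x))

/-- Adjoin the point `a` to the block `B` of `P`. -/
def addToBlock (a : ℕ) (P : Finset (Finset ℕ)) (B : Finset ℕ) : Finset (Finset ℕ) :=
  insert (insert a B) (P.erase B)

/-- Delete the point `a` from the block `C` of `P`. -/
def eraseFromBlock (a : ℕ) (P : Finset (Finset ℕ)) (C : Finset ℕ) : Finset (Finset ℕ) :=
  insert (C.erase a) (P.erase C)

theorem IsPartition.addToBlock {P : Finset (Finset ℕ)} {S B : Finset ℕ} {a : ℕ}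
    (h : IsPartition P S) (ha : a ∉ S) (hB : B ∈ P) :
    IsPartition (addToBlock a P B) (insert a S) := by
  have hn := fun B hB => h.notMem (B := B) ha hB
  rw [isPartition_iff] at h ⊢
  obtain ⟨h0, h1, h2⟩ := h
  unfold _root_.addToBlock
  refine ⟨?_, ?_, ?_⟩
  · simp [h0, (Finset.insert_ne_empty a B).symm]
  · intro C hC D hD x hxC hxD
    simp only [Finset.mem_insert, Finset.mem_erase] at hC hD
    rcases hC with rfl | hC <;> rcases hD with rfl | hD
    · rfl
    · have := hn D hD.2
      have := h1 B hB D hD.2 x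
      grind
    · have := hn C hC.2
      have := h1 B hB C hC.2 x
      grind
    · exact h1 C hC.2 D hD.2 x hxC hxD
  · intro x
    simp only [Finset.mem_insert, Finset.mem_erase, h2]
    constructor
    · rintro (rfl | ⟨C, hC, hxC⟩)
      · exact ⟨_, Or.inl rfl, Finset.mem_insert_self _ _⟩
      · by_cases hCB : C = B
        · exact ⟨_, Or.inl rfl, Finset.mem_insert_of_mem (hCB ▸ hxC)⟩
        · exact ⟨C, Or.inr ⟨hCB, hC⟩, hxC⟩
    · rintro ⟨C, rfl | hC, hxC⟩
      · exact (Finset.mem_insert.1 hxC).imp id fun h => ⟨B, hB, h⟩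
      · exact Or.inr ⟨C, hC.2, hxC⟩

theorem IsPartition.eraseFromBlock {P : Finset (Finset ℕ)} {S C : Finset ℕ} {a : ℕ}
    (h : IsPartition P (insert a S)) (ha : a ∉ S) (haP : {a} ∉ P) (hC : C ∈ P) (haC : a ∈ C) :
    IsPartition (eraseFromBlock a P C) S := by
  rw [isPartition_iff] at h ⊢
  obtain ⟨h0, h1, h2⟩ := h
  unfold _root_.eraseFromBlock
  refine ⟨?_, ?_, ?_⟩
  · rw [Finset.mem_insert, not_or]
    refine ⟨fun he => ?_, fun he => h0 (Finset.mem_of_mem_erase he)⟩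
    rcases (Finset.erase_eq_empty_iff C a).1 he.symm with rfl | rfl
    exacts [h0 hC, haP hC]
  · intro B hB D hD x hxB hxD
    simp only [Finset.mem_insert, Finset.mem_erase] at hB hD
    rcases hB with rfl | hB <;> rcases hD with rfl | hD
    · rfl
    · exact absurd (h1 D hD.2 C hC x hxD (Finset.mem_of_mem_erase hxB)) hD.1
    · exact absurd (h1 B hB.2 C hC x hxB (Finset.mem_of_mem_erase hxD)) hB.1
    · exact h1 B hB.2 D hD.2 x hxB hxD
  · intro x
    simp only [Finset.mem_insert, Finset.mem_erase]
    constructor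
    · intro hx
      have hxa : x ≠ a := by
        rintro rfl
        exact ha hx
      obtain ⟨B, hB, hxB⟩ := (h2 x).1 (Finset.mem_insert_of_mem hx)
      by_cases hBC : B = C
      · exact ⟨_, Or.inl rfl, Finset.mem_erase.2 ⟨hxa, hBC ▸ hxB⟩⟩
      · exact ⟨B, Or.inr ⟨hBC, hB⟩, hxB⟩
    · rintro ⟨B, rfl | hB, hxB⟩
      · obtain ⟨hxa, hxC⟩ := Finset.mem_erase.1 hxB
        exact Finset.mem_of_mem_insert_of_ne ((h2 x).2 ⟨C, hC, hxC⟩) hxa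
      · refine Finset.mem_of_mem_insert_of_ne ((h2 x).2 ⟨B, hB.2, hxB⟩) ?_
        rintro rfl
        exact hB.1 (h1 B hB.2 C hC x hxB haC)

theorem IsPartition.blockOf_eq {P : Finset (Finset ℕ)} {S C : Finset ℕ} {a : ℕ}
    (h : IsPartition P S) (hC : C ∈ P) (haC : a ∈ C) : blockOf P a = C := by
  have h1 := (isPartition_iff.1 h).2.1
  have : P.filter (fun B => a ∈ B) = {C} := by
    ext B
    simp only [Finset.mem_filter, Finset.mem_singleton]
    constructor
    · rintro ⟨hB, haB⟩
      exact h1 B hB C hC a haB haC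
    · rintro rfl
      exact ⟨hC, haC⟩
  rw [blockOf, this, Finset.singleton_biUnion, id]

theorem IsPartition.blockOf_mem {P : Finset (Finset ℕ)} {S : Finset ℕ} {a : ℕ}
    (h : IsPartition P S) (ha : a ∈ S) : blockOf P a ∈ P ∧ a ∈ blockOf P a := by
  obtain ⟨C, hC, haC⟩ := ((isPartition_iff.1 h).2.2 a).1 ha
  rw [h.blockOf_eq hC haC]
  exact ⟨hC, haC⟩

theorem card_addToBlock {P : Finset (Finset ℕ)} {B : Finset ℕ} {a : ℕ}
    (hn : ∀ C ∈ P, a ∉ C) (hB : B ∈ P) : (addToBlock a P B).card = P.card := by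
  rw [addToBlock, Finset.card_insert_of_notMem, Finset.card_erase_add_one hB]
  intro h
  exact hn _ (Finset.mem_of_mem_erase h) (Finset.mem_insert_self a B)

theorem eraseFromBlock_addToBlock {P : Finset (Finset ℕ)} {B : Finset ℕ} {a : ℕ}
    (hn : ∀ C ∈ P, a ∉ C) (hB : B ∈ P) :
    eraseFromBlock a (addToBlock a P B) (insert a B) = P := by
  have : insert a B ∉ P.erase B := fun h =>
    hn _ (Finset.mem_of_mem_erase h) (Finset.mem_insert_self a B)
  rw [eraseFromBlock, addToBlock, Finset.erase_insert this, Finset.erase_insert (hn B hB),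
    Finset.insert_erase hB]

theorem IsPartition.addToBlock_eraseFromBlock {P : Finset (Finset ℕ)} {S C : Finset ℕ} {a : ℕ}
    (h : IsPartition P S) (hC : C ∈ P) (haC : a ∈ C) :
    _root_.addToBlock a (_root_.eraseFromBlock a P C) (C.erase a) = P := by
  rw [isPartition_iff] at h
  obtain ⟨h0, h1, h2⟩ := h
  have : C.erase a ∉ P.erase C := by
    intro hm
    obtain ⟨hne, hm⟩ := Finset.mem_erase.1 hm
    obtain ⟨x, hx⟩ : (C.erase a).Nonempty := by
      rw [Finset.nonempty_iff_ne_empty]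
      exact fun he => h0 (he ▸ hm)
    exact hne (h1 _ hm C hC x hx (Finset.mem_of_mem_erase hx))
  rw [_root_.addToBlock, _root_.eraseFromBlock, Finset.erase_insert this,
    Finset.insert_erase haC, Finset.insert_erase hC]

theorem card_partitionsK_filter_singleton_mem (n k : ℕ) :
    ((partitionsK (n + 1) (k + 1)).filter fun P => {n + 1} ∈ P).card = stirling n k := by
  refine Finset.card_nbij' (fun P => P.erase {n + 1}) (fun P => insert {n + 1} P) ?_ ?_ ?_ ?_
  · intro P hP
    simp only [Finset.coe_filter, Set.mem_ofPred_eq, mem_partitionsK, seg_succ] at hP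
    obtain ⟨⟨hP, hc⟩, hm⟩ := hP
    rw [Finset.mem_coe, mem_partitionsK, Finset.card_erase_of_mem hm, hc]
    exact ⟨hP.erase_singleton (succ_notMem_seg n) hm, rfl⟩
  · intro P hP
    rw [Finset.mem_coe, mem_partitionsK] at hP
    simp only [Finset.coe_filter, Set.mem_ofPred_eq, mem_partitionsK, seg_succ]
    refine ⟨⟨hP.1.insert_singleton (succ_notMem_seg n), ?_⟩, Finset.mem_insert_self _ _⟩
    rw [Finset.card_insert_of_notMem, hP.2]
    exact fun h => hP.1.notMem (succ_notMem_seg n) h (Finset.mem_singleton_self _)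
  · intro P hP
    exact Finset.insert_erase (Finset.mem_filter.1 hP).2
  · intro P hP
    rw [Finset.mem_coe, mem_partitionsK] at hP
    exact Finset.erase_insert
      fun h => hP.1.notMem (succ_notMem_seg n) h (Finset.mem_singleton_self _)

theorem card_partitionsK_filter_singleton_notMem (n k : ℕ) :
    ((partitionsK (n + 1) k).filter fun P => {n + 1} ∉ P).card = k * stirling n k := by
  have hs : ((partitionsK n k).sigma fun P => P).card = k * stirling n k := by
    rw [Finset.card_sigma, Finset.sum_congr rfl fun P hP => (mem_partitionsK.1 hP).2,
      Finset.sum_const, smul_eq_mul, mul_comm, stirling]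
  rw [← hs]
  have hn := succ_notMem_seg n
  refine Finset.card_nbij'
    (fun P => ⟨eraseFromBlock (n + 1) P (blockOf P (n + 1)), (blockOf P (n + 1)).erase (n + 1)⟩)
    (fun p => addToBlock (n + 1) p.1 p.2) ?_ ?_ ?_ ?_
  · intro P hP
    simp only [Finset.coe_filter, Set.mem_ofPred_eq, mem_partitionsK, seg_succ] at hP
    obtain ⟨⟨hP, hc⟩, hm⟩ := hP
    obtain ⟨hb, hab⟩ := hP.blockOf_mem (Finset.mem_insert_self _ _)
    have hQ := hP.eraseFromBlock hn hm hb hab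
    have hB : (blockOf P (n + 1)).erase (n + 1) ∈
        eraseFromBlock (n + 1) P (blockOf P (n + 1)) := Finset.mem_insert_self _ _
    rw [Finset.mem_coe, Finset.mem_sigma, mem_partitionsK]
    refine ⟨⟨hQ, ?_⟩, hB⟩
    rw [← card_addToBlock (fun C hC => hQ.notMem hn hC) hB,
      hP.addToBlock_eraseFromBlock hb hab, hc]
  · rintro ⟨P, B⟩ hP
    rw [Finset.mem_coe, Finset.mem_sigma, mem_partitionsK] at hP
    obtain ⟨⟨hP, hc⟩, hB⟩ := hP
    have hnP := fun C hC => hP.notMem (B := C) hn hC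
    simp only [Finset.coe_filter, Set.mem_ofPred_eq, mem_partitionsK, seg_succ]
    refine ⟨⟨hP.addToBlock hn hB, (card_addToBlock hnP hB).trans hc⟩, fun h => ?_⟩
    rcases Finset.mem_insert.1 h with h | h
    · have hBe : B = ∅ := by
        have := congrArg (fun C => C.erase (n + 1)) h
        simpa [Finset.erase_insert (hnP B hB)] using this.symm
      exact hP.1 (hBe ▸ hB)
    · exact hnP _ (Finset.mem_of_mem_erase h) (Finset.mem_singleton_self _)
  · intro P hP
    simp only [Finset.coe_filter, Set.mem_ofPred_eq, mem_partitionsK, seg_succ] at hP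
    obtain ⟨⟨hP, hc⟩, hm⟩ := hP
    obtain ⟨hb, hab⟩ := hP.blockOf_mem (Finset.mem_insert_self _ _)
    exact hP.addToBlock_eraseFromBlock hb hab
  · rintro ⟨P, B⟩ hP
    rw [Finset.mem_coe, Finset.mem_sigma, mem_partitionsK] at hP
    obtain ⟨⟨hP, hc⟩, hB⟩ := hP
    have hnP := fun C hC => hP.notMem (B := C) hn hC
    have hb : blockOf (addToBlock (n + 1) P B) (n + 1) = insert (n + 1) B :=
      (hP.addToBlock hn hB).blockOf_eq (Finset.mem_insert_self _ _) (Finset.mem_insert_self _ _)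
    simp only [hb, eraseFromBlock_addToBlock hnP hB, Finset.erase_insert (hnP B hB)]

theorem stirling_succ_succ (n k : ℕ) :
    stirling (n + 1) (k + 1) = stirling n k + (k + 1) * stirling n (k + 1) := by
  have h := card_partitionsK_filter_singleton_notMem n (k + 1)
  rw [← card_partitionsK_filter_singleton_mem n k, ← h, Finset.card_filter_add_card_filter_not,
    stirling]

theorem stirling_succ_zero (n : ℕ) : stirling (n + 1) 0 = 0 := by
  rw [stirling, Finset.card_eq_zero, Finset.eq_empty_iff_forall_notMem]
  intro P hP
  rw [mem_partitionsK, Finset.card_eq_zero] at hP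
  obtain ⟨hP, rfl⟩ := hP
  simpa using (hP.blockOf_mem (a := n + 1) (by simp [seg])).1

theorem isPartition_empty_iff {P : Finset (Finset ℕ)} : IsPartition P ∅ ↔ P = ∅ := by
  rw [isPartition_iff]
  constructor
  · rintro ⟨h0, -, h2⟩
    rw [Finset.eq_empty_iff_forall_notMem]
    intro B hB
    rcases B.eq_empty_or_nonempty with rfl | ⟨x, hx⟩
    · exact h0 hB
    · exact Finset.notMem_empty x ((h2 x).2 ⟨B, hB, hx⟩)
  · rintro rfl
    simp

theorem stirling_eq_stirlingSecond (n k : ℕ) : stirling n k = Nat.stirlingSecond n k := by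
  induction n generalizing k with
  | zero =>
    have h : partitionsK 0 k = if k = 0 then {∅} else ∅ := by
      ext P
      rw [mem_partitionsK, show seg 0 = ∅ from rfl, isPartition_empty_iff]
      split_ifs with hk
      · subst hk
        simp
      · simp only [Finset.notMem_empty, iff_false, not_and]
        rintro rfl h
        exact hk h.symm
    cases k <;> simp [stirling, h]
  | succ n ih =>
    cases k with
    | zero => rw [stirling_succ_zero, Nat.stirlingSecond_succ_zero]
    | succ k => rw [stirling_succ_succ, Nat.stirlingSecond_succ_succ, ih, ih, add_comm]

theorem card_le_of_mem_partitions {n : ℕ} {P : Finset (Finset ℕ)} (hP : P ∈ partitions n) :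
    P.card ≤ n := by
  by_contra! h
  have h0 := Nat.stirlingSecond_eq_zero_of_lt h
  rw [← stirling_eq_stirlingSecond, stirling, Finset.card_eq_zero] at h0
  have : P ∈ partitionsK n P.card := mem_partitionsK.2 ⟨mem_partitions.1 hP, rfl⟩
  simp [h0] at this

theorem card_pos_of_mem_partitions {n : ℕ} (hn : 1 ≤ n) {P : Finset (Finset ℕ)}
    (hP : P ∈ partitions n) : 1 ≤ P.card :=
  Finset.card_pos.2 ⟨_, ((mem_partitions.1 hP).blockOf_mem (a := n) (by simp [seg, hn])).1⟩

theorem bell_eq_sum_stirlingSecond {n N : ℕ} (h : n < N) :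
    bell n = ∑ k ∈ Finset.range N, Nat.stirlingSecond n k := by
  rw [bell, Finset.card_eq_sum_card_fiberwise (f := Finset.card) (t := Finset.range N)]
  · exact Finset.sum_congr rfl fun k _ => stirling_eq_stirlingSecond n k
  · intro P hP
    have := card_le_of_mem_partitions hP
    simp only [Finset.coe_range, Set.mem_Iio]
    omega

theorem qS_eval_one (n k : ℕ) : (qS n k).eval 1 = (Nat.stirlingSecond n k : ℚ) := by
  induction n generalizing k with
  | zero => cases k <;> simp [qS]
  | succ n ih =>
    cases k with
    | zero => simp [qS]
    | succ k =>
      simp [qS, ih, Nat.stirlingSecond_succ_succ, Polynomial.eval_finsetSum]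
      ring

/-- The value at `1` of the derivative of the `q`-Stirling polynomial. -/
noncomputable def qSDeriv (n k : ℕ) : ℚ := (Polynomial.derivative (qS n k)).eval 1

theorem qSDeriv_succ_zero (n : ℕ) : qSDeriv (n + 1) 0 = 0 := by
  simp [qSDeriv, qS]

theorem qSDeriv_zero_left (k : ℕ) : qSDeriv 0 k = 0 := by
  cases k <;> simp [qSDeriv, qS]

theorem qSDeriv_succ_succ (n k : ℕ) :
    qSDeriv (n + 1) (k + 1) = k * Nat.stirlingSecond n k + qSDeriv n k
      + (k + 1) * qSDeriv n (k + 1) + k * (k + 1) / 2 * Nat.stirlingSecond n (k + 1) := by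
  have hsum : (∑ i ∈ Finset.range (k + 1), (i : ℚ)) = k * (k + 1) / 2 := by
    induction k with
    | zero => simp
    | succ k ih =>
      rw [Finset.sum_range_succ, ih]
      push_cast
      ring
  simp [qSDeriv, qS, Polynomial.derivative_mul, Polynomial.eval_finsetSum,
    Polynomial.derivative_X_pow, qS_eval_one, hsum]
  ring

theorem qSDeriv_eq_zero_of_lt {n k : ℕ} (h : n < k) : qSDeriv n k = 0 := by
  induction n generalizing k with
  | zero => exact qSDeriv_zero_left k
  | succ n ih =>
    obtain ⟨k, rfl⟩ : ∃ j, k = j + 1 := ⟨k - 1, by omega⟩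
    rw [qSDeriv_succ_succ, ih (by omega), ih (by omega),
      Nat.stirlingSecond_eq_zero_of_lt (by omega), Nat.stirlingSecond_eq_zero_of_lt (by omega)]
    simp

theorem qSDeriv_zero_right (n : ℕ) : qSDeriv n 0 = 0 := by
  cases n with
  | zero => exact qSDeriv_zero_left 0
  | succ n => exact qSDeriv_succ_zero n

theorem qSDeriv_one_right (n : ℕ) : qSDeriv n 1 = 0 := by
  induction n with
  | zero => exact qSDeriv_zero_left 1
  | succ n ih => simp [qSDeriv_succ_succ, qSDeriv_zero_right, ih]

theorem qSDeriv_add_two (n k : ℕ) :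
    qSDeriv n (k + 2) =
      n / 2 * (Nat.stirlingSecond (n + 1) (k + 2) - Nat.stirlingSecond n (k + 2))
        - 1 / 4 * (Nat.stirlingSecond (n + 2) (k + 2) - Nat.stirlingSecond (n + 1) (k + 2)
          - Nat.stirlingSecond n k) := by
  induction n generalizing k with
  | zero =>
    rw [qSDeriv_zero_left]
    rcases k with _ | k <;> simp [Nat.stirlingSecond]
  | succ n ih =>
    rcases k with _ | k
    · rw [qSDeriv_succ_succ, qSDeriv_one_right, ih]
      rcases n with _ | n
      · norm_num [Nat.stirlingSecond]
      · simp [Nat.stirlingSecond_succ_succ, Nat.stirlingSecond_succ_zero]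
        ring
    · rw [qSDeriv_succ_succ, ih, ih]
      simp only [Nat.stirlingSecond_succ_succ]
      push_cast
      ring

theorem sum_qSDeriv (n : ℕ) (hn : 1 ≤ n) :
    ∑ k ∈ Finset.Icc 1 n, qSDeriv n k =
      -(1/4) * (bell (n+2) : ℚ) + ((n : ℚ)/2 + 1/4) * (bell (n+1) : ℚ)
        + (-(n : ℚ)/2 + 1/4) * (bell n : ℚ) := by
  have hD : ∑ k ∈ Finset.Icc 1 n, qSDeriv n k = ∑ k ∈ Finset.range (n + 1), qSDeriv n (k + 2) := by
    have h : ∑ k ∈ Finset.Icc 1 n, qSDeriv n k = ∑ k ∈ Finset.range (n + 3), qSDeriv n k := by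
      refine Finset.sum_subset (fun k hk => ?_) (fun k _ hk => ?_)
      · rw [Finset.mem_Icc] at hk
        rw [Finset.mem_range]
        omega
      · rw [Finset.mem_Icc] at hk
        rcases Nat.eq_zero_or_pos k with rfl | hk0
        · exact qSDeriv_zero_right n
        · exact qSDeriv_eq_zero_of_lt (by omega)
    rw [h, Finset.sum_range_succ', Finset.sum_range_succ', qSDeriv_zero_right, qSDeriv_one_right,
      add_zero, add_zero]
  obtain ⟨n, rfl⟩ : ∃ m, n = m + 1 := ⟨n - 1, by omega⟩
  have hone : ∀ m, Nat.stirlingSecond (m + 1) 1 = 1 := Nat.stirlingSecond_one_right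
  have hB : ∀ m, m < n + 3 → (bell (m + 1) : ℚ) =
      1 + ∑ k ∈ Finset.range (n + 2), (Nat.stirlingSecond (m + 1) (k + 2) : ℚ) := by
    intro m hm
    rw [bell_eq_sum_stirlingSecond (show m + 1 < n + 4 by omega), Finset.sum_range_succ',
      Finset.sum_range_succ', Nat.stirlingSecond_succ_zero, hone]
    push_cast
    ring
  have hB' : (bell (n + 1) : ℚ) =
      ∑ k ∈ Finset.range (n + 2), (Nat.stirlingSecond (n + 1) k : ℚ) := by
    rw [bell_eq_sum_stirlingSecond (show n + 1 < n + 2 by omega)]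
    push_cast
    rfl
  have h0 := hB n (by omega)
  have h1 := hB (n + 1) (by omega)
  have h2 := hB (n + 2) (by omega)
  rw [hD]
  simp only [qSDeriv_add_two, Finset.sum_sub_distrib, ← Finset.mul_sum, ← hB']
  linear_combination (1/4) * h2 - ((n + 1 : ℕ) / 2 + 1/4 : ℚ) * h1 + ((n + 1 : ℕ) / 2 : ℚ) * h0

/-- sum of derivatives of the `q`-Stirling polynomials at `q = 1`,
and the average value of any statistic with the `q`-Stirling distribution `S(q)`. -/
theorem qStirling_mean_over_partitions (n : ℕ) (hn : 1 ≤ n) :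
    (∑ k ∈ Finset.Icc 1 n, (Polynomial.derivative (qS n k)).eval (1 : ℚ))
        = -(1/4) * (bell (n+2) : ℚ) + ((n : ℚ)/2 + 1/4) * (bell (n+1) : ℚ)
            + (-(n : ℚ)/2 + 1/4) * (bell n : ℚ) ∧
    ∀ stat : Finset (Finset ℕ) → ℕ,
      (∀ k, 1 ≤ k → k ≤ n →
        (∑ π ∈ partitionsK n k, (Polynomial.X : Polynomial ℚ) ^ stat π) = qS n k) →
      (∑ π ∈ partitions n, (stat π : ℚ)) / (bell n : ℚ)
        = (-(1/4) * (bell (n+2) : ℚ) + ((n : ℚ)/2 + 1/4) * (bell (n+1) : ℚ)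
            + (-(n : ℚ)/2 + 1/4) * (bell n : ℚ)) / (bell n : ℚ) := by
  have hsum := sum_qSDeriv n hn
  refine ⟨hsum, fun stat hstat => ?_⟩
  rw [← hsum]
  congr 1
  have hmaps : ∀ P ∈ partitions n, P.card ∈ Finset.Icc 1 n := fun P hP =>
    Finset.mem_Icc.2 ⟨card_pos_of_mem_partitions hn hP, card_le_of_mem_partitions hP⟩
  rw [← Finset.sum_fiberwise_of_maps_to hmaps]
  refine Finset.sum_congr rfl fun k hk => ?_
  rw [Finset.mem_Icc] at hk
  rw [qSDeriv, ← hstat k hk.1 hk.2]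
  simp [Polynomial.eval_finsetSum, Polynomial.derivative_X_pow,
    partitionsK]
end

section
/- For every integer n ≥ 1 one has the identity (in ℚ): Σ_{π ∈ Π_n} crol(π) = −(5/4)·B_{n+2} + (n/2 + 9/4)·B_{n+1} + (n/2 + 1/4)·B_n. Equivalently, the average number of linear crossings in a random set partition of [n] equals −(5/4)·B_{n+2}/B_n + (n/2 + 9/4)·B_{n+1}/B_n + (n/2 + 1/4). -/
open scoped Classical

theorem mem_partitions_iff {n : ℕ} {P : Finset (Finset ℕ)} :
    P ∈ partitions n ↔ ∅ ∉ P ∧ (∀ B ∈ P, ∀ C ∈ P, ∀ x ∈ B, x ∈ C → B = C) ∧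
      ∀ x, (∃ B ∈ P, x ∈ B) ↔ 1 ≤ x ∧ x ≤ n := by
  have h : P.biUnion id = seg n ↔ ∀ x, (∃ B ∈ P, x ∈ B) ↔ 1 ≤ x ∧ x ≤ n := by
    simp [Finset.ext_iff, seg]
  unfold partitions IsPartition
  simp only [Finset.mem_filter, h]
  constructor
  · rintro ⟨-, h0, h1, h2⟩
    refine ⟨h0, fun B hB C hC x hxB hxC => ?_, h2⟩
    by_contra hne
    exact Finset.disjoint_left.1 (h1 B hB C hC hne) hxB hxC
  · rintro ⟨h0, h1, h2⟩
    refine ⟨?_, h0, fun B hB C hC hne => ?_, h2⟩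
    · simp only [Finset.mem_powerset]
      intro B hB
      rw [Finset.mem_powerset]
      intro x hx
      exact Finset.mem_Icc.2 ((h2 x).1 ⟨B, hB, hx⟩)
    · rw [Finset.disjoint_left]
      intro x hxB hxC
      exact hne (h1 B hB C hC x hxB hxC)

/-- Add `n + 1` to the block `D` of `P`; for `D = ∅` this adds the singleton block `{n + 1}`. -/
noncomputable def extendBlock (n : ℕ) (P : Finset (Finset ℕ)) (D : Finset ℕ) :
    Finset (Finset ℕ) :=
  insert (insert (n + 1) D) (P.erase D)

theorem mem_extendBlock {n : ℕ} {P : Finset (Finset ℕ)} {D B : Finset ℕ} :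
    B ∈ extendBlock n P D ↔ B = insert (n + 1) D ∨ B ≠ D ∧ B ∈ P := by
  simp [extendBlock]

theorem le_of_mem_block {n : ℕ} {P : Finset (Finset ℕ)} (hP : P ∈ partitions n)
    {B : Finset ℕ} (hB : B ∈ insert ∅ P) {x : ℕ} (hx : x ∈ B) : x ≤ n := by
  rw [mem_partitions_iff] at hP
  rcases Finset.mem_insert.1 hB with rfl | hB
  · simp at hx
  · exact ((hP.2.2 x).1 ⟨B, hB, hx⟩).2

theorem succ_notMem_block {n : ℕ} {P : Finset (Finset ℕ)} (hP : P ∈ partitions n)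
    {B : Finset ℕ} (hB : B ∈ insert ∅ P) : n + 1 ∉ B := fun h => by
  have := le_of_mem_block hP hB h
  omega

theorem nonempty_of_mem_partition {n : ℕ} {P : Finset (Finset ℕ)} (hP : P ∈ partitions n)
    {B : Finset ℕ} (hB : B ∈ P) : B.Nonempty := by
  rw [mem_partitions_iff] at hP
  rw [Finset.nonempty_iff_ne_empty]
  rintro rfl
  exact hP.1 hB

theorem extendBlock_mem {n : ℕ} {P : Finset (Finset ℕ)} (hP : P ∈ partitions n)
    {D : Finset ℕ} (hD : D ∈ insert ∅ P) : extendBlock n P D ∈ partitions (n + 1) := by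
  have hle := @le_of_mem_block n P hP
  have hns := @succ_notMem_block n P hP
  rw [mem_partitions_iff] at hP ⊢
  obtain ⟨h0, h1, h2⟩ := hP
  have key : ∀ B ∈ P, B ≠ D → ∀ x ∈ B, x ∉ insert (n + 1) D := by
    intro B hB hBD x hx hxD
    rcases Finset.mem_insert.1 hxD with rfl | hxD
    · exact hns (Finset.mem_insert_of_mem hB) hx
    · rcases Finset.mem_insert.1 hD with rfl | hD
      · simp at hxD
      · exact hBD (h1 B hB D hD x hx hxD)
  refine ⟨?_, ?_, ?_⟩
  · rw [mem_extendBlock]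
    rintro (h | h)
    · exact (Finset.insert_ne_empty _ _) h.symm
    · exact h0 h.2
  · intro B hB C hC x hxB hxC
    rw [mem_extendBlock] at hB hC
    rcases hB with rfl | ⟨hBD, hB⟩ <;> rcases hC with rfl | ⟨hCD, hC⟩
    · rfl
    · exact absurd hxB (key C hC hCD x hxC)
    · exact absurd hxC (key B hB hBD x hxB)
    · exact h1 B hB C hC x hxB hxC
  · intro x
    constructor
    · rintro ⟨B, hB, hx⟩
      rw [mem_extendBlock] at hB
      rcases hB with rfl | ⟨hBD, hB⟩
      · rcases Finset.mem_insert.1 hx with rfl | hx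
        · omega
        · rcases Finset.mem_insert.1 hD with rfl | hD
          · simp at hx
          · have := (h2 x).1 ⟨D, hD, hx⟩
            omega
      · have := (h2 x).1 ⟨B, hB, hx⟩
        omega
    · rintro ⟨hx1, hx2⟩
      rcases Nat.lt_or_ge n x with h | h
      · obtain rfl : x = n + 1 := by omega
        exact ⟨_, mem_extendBlock.2 (Or.inl rfl), Finset.mem_insert_self _ _⟩
      · obtain ⟨B, hB, hx⟩ := (h2 x).2 ⟨hx1, h⟩
        by_cases hBD : B = D
        · subst hBD
          exact ⟨_, mem_extendBlock.2 (Or.inl rfl), Finset.mem_insert_of_mem hx⟩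
        · exact ⟨B, mem_extendBlock.2 (Or.inr ⟨hBD, hB⟩), hx⟩

theorem extendBlock_subset_of_eq {n : ℕ} {P Q : Finset (Finset ℕ)} (hP : P ∈ partitions n)
    {D : Finset ℕ} (hE : D ∈ insert ∅ Q)
    (h : extendBlock n P D = extendBlock n Q D) : P ⊆ Q := by
  intro B hB
  by_cases hBD : B = D
  · subst hBD
    rcases Finset.mem_insert.1 hE with rfl | hE
    · exact absurd hB (mem_partitions_iff.1 hP).1
    · exact hE
  · have : B ∈ extendBlock n Q D := h ▸ mem_extendBlock.2 (Or.inr ⟨hBD, hB⟩)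
    rcases mem_extendBlock.1 this with rfl | h
    · exact absurd (Finset.mem_insert_self _ _)
        (succ_notMem_block hP (Finset.mem_insert_of_mem hB))
    · exact h.2

theorem extendBlock_injective {n : ℕ} {P Q : Finset (Finset ℕ)} (hP : P ∈ partitions n)
    (hQ : Q ∈ partitions n) {D E : Finset ℕ} (hD : D ∈ insert ∅ P) (hE : E ∈ insert ∅ Q)
    (h : extendBlock n P D = extendBlock n Q E) : P = Q ∧ D = E := by
  have hDE : D = E := by
    have : insert (n + 1) D ∈ extendBlock n Q E := h ▸ mem_extendBlock.2 (Or.inl rfl)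
    rcases mem_extendBlock.1 this with h' | ⟨-, h'⟩
    · rw [← Finset.erase_insert (succ_notMem_block hP hD), h',
        Finset.erase_insert (succ_notMem_block hQ hE)]
    · exact absurd (Finset.mem_insert_self _ _)
        (succ_notMem_block hQ (Finset.mem_insert_of_mem h'))
  subst hDE
  exact ⟨Finset.Subset.antisymm (extendBlock_subset_of_eq hP hE h)
    (extendBlock_subset_of_eq hQ hD h.symm), rfl⟩

theorem exists_extendBlock_eq {n : ℕ} {R : Finset (Finset ℕ)} (hR : R ∈ partitions (n + 1)) :
    ∃ P ∈ partitions n, ∃ D ∈ insert ∅ P, extendBlock n P D = R := by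
  obtain ⟨h0, h1, h2⟩ := mem_partitions_iff.1 hR
  obtain ⟨C, hC, hnC⟩ := (h2 (n + 1)).2 (by omega)
  have hmem : ∀ B, B ∈ (insert (C.erase (n + 1)) (R.erase C)).erase ∅ ↔
      B ≠ ∅ ∧ (B = C.erase (n + 1) ∨ B ≠ C ∧ B ∈ R) := by
    intro B; simp
  have hsub : ∀ x, x ∈ C.erase (n + 1) → x ∈ C := fun x hx => Finset.mem_of_mem_erase hx
  refine ⟨(insert (C.erase (n + 1)) (R.erase C)).erase ∅, ?_, C.erase (n + 1), ?_, ?_⟩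
  · rw [mem_partitions_iff]
    refine ⟨by simp, ?_, ?_⟩
    · intro A hA B hB x hxA hxB
      rcases (hmem A).1 hA with ⟨-, rfl | ⟨hAC, hA⟩⟩ <;>
        rcases (hmem B).1 hB with ⟨-, rfl | ⟨hBC, hB⟩⟩
      · rfl
      · exact absurd (h1 B hB C hC x hxB (hsub x hxA)) hBC
      · exact absurd (h1 A hA C hC x hxA (hsub x hxB)) hAC
      · exact h1 A hA B hB x hxA hxB
    · intro x
      constructor
      · rintro ⟨B, hB, hx⟩
        rcases (hmem B).1 hB with ⟨-, rfl | ⟨hBC, hB⟩⟩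
        · have := (h2 x).1 ⟨C, hC, hsub x hx⟩
          have := Finset.ne_of_mem_erase hx
          omega
        · have := (h2 x).1 ⟨B, hB, hx⟩
          have : x ≠ n + 1 := by
            rintro rfl
            exact hBC (h1 B hB C hC _ hx hnC)
          omega
      · rintro ⟨hx1, hx2⟩
        obtain ⟨B, hB, hx⟩ := (h2 x).2 ⟨hx1, by omega⟩
        by_cases hBC : B = C
        · subst hBC
          have hx' : x ∈ B.erase (n + 1) := Finset.mem_erase.2 ⟨by omega, hx⟩
          exact ⟨_, (hmem _).2 ⟨Finset.ne_empty_of_mem hx', Or.inl rfl⟩, hx'⟩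
        · exact ⟨B, (hmem _).2 ⟨Finset.ne_empty_of_mem hx, Or.inr ⟨hBC, hB⟩⟩, hx⟩
  · by_cases h : C.erase (n + 1) = ∅
    · rw [h]; exact Finset.mem_insert_self _ _
    · exact Finset.mem_insert_of_mem ((hmem _).2 ⟨h, Or.inl rfl⟩)
  · ext B
    rw [mem_extendBlock, hmem, Finset.insert_erase hnC]
    constructor
    · rintro (rfl | ⟨h, -, h' | h'⟩)
      · exact hC
      · exact absurd h' h
      · exact h'.2
    · intro hB
      by_cases hBC : B = C
      · exact Or.inl hBC
      · have hne : B ≠ ∅ := fun h => h0 (h ▸ hB)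
        refine Or.inr ⟨?_, hne, Or.inr ⟨hBC, hB⟩⟩
        rintro rfl
        obtain ⟨x, hx⟩ := Finset.nonempty_iff_ne_empty.2 hne
        exact hBC (h1 _ hB C hC x hx (hsub x hx))

theorem sum_partitions_succ (n : ℕ) (F : Finset (Finset ℕ) → ℚ) :
    ∑ R ∈ partitions (n + 1), F R =
      ∑ P ∈ partitions n, (F (extendBlock n P ∅) + ∑ D ∈ P, F (extendBlock n P D)) := by
  have h : ∀ P ∈ partitions n, F (extendBlock n P ∅) + ∑ D ∈ P, F (extendBlock n P D) =
      ∑ D ∈ insert ∅ P, F (extendBlock n P D) := fun P hP =>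
    (Finset.sum_insert (f := fun D => F (extendBlock n P D)) (mem_partitions_iff.1 hP).1).symm
  rw [Finset.sum_congr rfl h, Finset.sum_sigma']
  symm
  refine Finset.sum_bij (fun x _ => extendBlock n x.1 x.2) ?_ ?_ ?_ fun _ _ => rfl
  · rintro ⟨P, D⟩ hx
    rw [Finset.mem_sigma] at hx
    exact extendBlock_mem hx.1 hx.2
  · rintro ⟨P, D⟩ hx ⟨Q, E⟩ hy hxy
    rw [Finset.mem_sigma] at hx hy
    obtain ⟨rfl, rfl⟩ := extendBlock_injective hx.1 hy.1 hx.2 hy.2 hxy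
    rfl
  · intro R hR
    obtain ⟨P, hP, D, hD, rfl⟩ := exists_extendBlock_eq hR
    exact ⟨⟨P, D⟩, Finset.mem_sigma.2 ⟨hP, hD⟩, rfl⟩

theorem succ_insert_notMem_erase {n : ℕ} {P : Finset (Finset ℕ)} (hP : P ∈ partitions n)
    (D : Finset ℕ) : insert (n + 1) D ∉ P.erase D := fun h =>
  succ_notMem_block hP (Finset.mem_insert_of_mem (Finset.mem_of_mem_erase h))
    (Finset.mem_insert_self _ _)

theorem card_extendBlock_empty {n : ℕ} {P : Finset (Finset ℕ)} (hP : P ∈ partitions n) :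
    (extendBlock n P ∅).card = P.card + 1 := by
  rw [extendBlock, Finset.card_insert_of_notMem (succ_insert_notMem_erase hP _),
    Finset.erase_eq_of_notMem (mem_partitions_iff.1 hP).1]

theorem card_extendBlock {n : ℕ} {P : Finset (Finset ℕ)} (hP : P ∈ partitions n)
    {D : Finset ℕ} (hD : D ∈ P) : (extendBlock n P D).card = P.card := by
  rw [extendBlock, Finset.card_insert_of_notMem (succ_insert_notMem_erase hP _),
    Finset.card_erase_add_one hD]

/-- The indicator that all elements of `B` are smaller than all elements of `C`. -/
noncomputable def precedes (B C : Finset ℕ) : ℚ := if ∀ b ∈ B, ∀ c ∈ C, b < c then 1 else 0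

/-- The number of pairs of blocks `(B, C)` of `P` with `B` entirely to the left of `C`. -/
noncomputable def precedingPairs (P : Finset (Finset ℕ)) : ℚ :=
  ∑ B ∈ P, ∑ C ∈ P, precedes B C

theorem precedingPairs_extendBlock {n : ℕ} {P : Finset (Finset ℕ)} (hP : P ∈ partitions n)
    {D : Finset ℕ} (hD : D ∈ insert ∅ P) :
    precedingPairs (extendBlock n P D) =
      ∑ B ∈ P.erase D, ∑ C ∈ P.erase D, precedes B C +
        ∑ B ∈ P.erase D, precedes B (insert (n + 1) D) := by
  have hz : ∀ C : Finset ℕ, C.Nonempty → (∀ c ∈ C, c ≤ n + 1) →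
      precedes (insert (n + 1) D) C = 0 := by
    rintro C ⟨c, hc⟩ hle
    refine if_neg fun h => ?_
    have h1 := h (n + 1) (Finset.mem_insert_self _ _) c hc
    have h2 := hle c hc
    omega
  have hz1 : precedes (insert (n + 1) D) (insert (n + 1) D) = 0 := by
    refine hz _ (Finset.insert_nonempty _ _) fun c hc => ?_
    rcases Finset.mem_insert.1 hc with rfl | hc
    · exact le_rfl
    · exact (le_of_mem_block hP hD hc).trans (Nat.le_succ n)
  have hz2 : ∑ C ∈ P.erase D, precedes (insert (n + 1) D) C = 0 := by
    refine Finset.sum_eq_zero fun C hC => ?_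
    have hC := Finset.mem_of_mem_erase hC
    exact hz C (nonempty_of_mem_partition hP hC) fun c hc =>
      (le_of_mem_block hP (Finset.mem_insert_of_mem hC) hc).trans (Nat.le_succ n)
  have hn := succ_insert_notMem_erase hP D
  simp only [precedingPairs, extendBlock, Finset.sum_insert hn, Finset.sum_add_distrib]
  rw [hz1, hz2]
  ring

theorem precedingPairs_extendBlock_empty {n : ℕ} {P : Finset (Finset ℕ)}
    (hP : P ∈ partitions n) :
    precedingPairs (extendBlock n P ∅) = precedingPairs P + P.card := by
  rw [precedingPairs_extendBlock hP (Finset.mem_insert_self _ _),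
    Finset.erase_eq_of_notMem (mem_partitions_iff.1 hP).1]
  have : ∀ B ∈ P, precedes B (insert (n + 1) ∅) = 1 := by
    intro B hB
    refine if_pos fun b hb c hc => ?_
    have := le_of_mem_block hP (Finset.mem_insert_of_mem hB) hb
    simp at hc
    omega
  rw [Finset.sum_congr rfl this]
  simp [precedingPairs]

theorem precedingPairs_extendBlock_of_mem {n : ℕ} {P : Finset (Finset ℕ)}
    (hP : P ∈ partitions n) {D : Finset ℕ} (hD : D ∈ P) :
    precedingPairs (extendBlock n P D) = precedingPairs P - ∑ C ∈ P, precedes D C := by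
  rw [precedingPairs_extendBlock hP (Finset.mem_insert_of_mem hD)]
  obtain ⟨d, hd⟩ := nonempty_of_mem_partition hP hD
  have : ∀ B ∈ P.erase D, precedes B (insert (n + 1) D) = precedes B D := by
    intro B hB
    have hB := Finset.mem_of_mem_erase hB
    unfold precedes
    congr 1
    refine propext ⟨fun h b hb c hc => h b hb c (Finset.mem_insert_of_mem hc),
      fun h b hb c hc => ?_⟩
    rcases Finset.mem_insert.1 hc with rfl | hc
    · have := le_of_mem_block hP (Finset.mem_insert_of_mem hB) hb
      omega
    · exact h b hb c hc
  rw [Finset.sum_congr rfl this, precedingPairs, ← Finset.add_sum_erase P _ hD,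
    add_sub_cancel_left, ← Finset.sum_add_distrib]
  refine Finset.sum_congr rfl fun B _ => ?_
  rw [← Finset.add_sum_erase P _ hD, add_comm]

theorem sum_precedingPairs_extendBlock {n : ℕ} {P : Finset (Finset ℕ)}
    (hP : P ∈ partitions n) :
    ∑ D ∈ P, precedingPairs (extendBlock n P D) = (P.card - 1) * precedingPairs P := by
  rw [Finset.sum_congr rfl fun D hD => precedingPairs_extendBlock_of_mem hP hD,
    Finset.sum_sub_distrib, Finset.sum_const, nsmul_eq_mul]
  change _ - precedingPairs P = _
  ring

theorem isEdge_extendBlock {n : ℕ} {P : Finset (Finset ℕ)} (hP : P ∈ partitions n)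
    {D : Finset ℕ} (hD : D ∈ insert ∅ P) {i j : ℕ} :
    IsEdge (extendBlock n P D) i j ↔
      IsEdge P i j ∨ j = n + 1 ∧ i ∈ D ∧ ∀ p ∈ D, p ≤ i := by
  have hle : ∀ {x}, x ∈ D → x ≤ n := fun hx => le_of_mem_block hP hD hx
  constructor
  · rintro ⟨hij, B, hB, hi, hj, hb⟩
    rcases mem_extendBlock.1 hB with rfl | ⟨hBD, hB⟩
    · have hi' : i ∈ D := by
        rcases Finset.mem_insert.1 hi with rfl | hi
        · rcases Finset.mem_insert.1 hj with rfl | hj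
          · omega
          · have := hle hj
            omega
        · exact hi
      rcases Finset.mem_insert.1 hj with rfl | hj
      · refine Or.inr ⟨rfl, hi', fun p hp => ?_⟩
        have h1 := hb p (Finset.mem_insert_of_mem hp)
        have h2 := hle hp
        omega
      · have hDP : D ∈ P := by
          rcases Finset.mem_insert.1 hD with rfl | hD
          · simp at hj
          · exact hD
        exact Or.inl ⟨hij, D, hDP, hi', hj, fun p hp => hb p (Finset.mem_insert_of_mem hp)⟩
    · exact Or.inl ⟨hij, B, hB, hi, hj, hb⟩
  · rintro (⟨hij, B, hB, hi, hj, hb⟩ | ⟨rfl, hi, hmax⟩)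
    · by_cases hBD : B = D
      · subst hBD
        refine ⟨hij, _, mem_extendBlock.2 (Or.inl rfl), Finset.mem_insert_of_mem hi,
          Finset.mem_insert_of_mem hj, fun p hp => ?_⟩
        rcases Finset.mem_insert.1 hp with rfl | hp
        · have := hle hj
          omega
        · exact hb p hp
      · exact ⟨hij, B, mem_extendBlock.2 (Or.inr ⟨hBD, hB⟩), hi, hj, hb⟩
    · refine ⟨by have := hle hi; omega, _, mem_extendBlock.2 (Or.inl rfl),
        Finset.mem_insert_of_mem hi, Finset.mem_insert_self _ _, fun p hp => ?_⟩
      rcases Finset.mem_insert.1 hp with rfl | hp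
      · omega
      · have := hmax p hp
        omega

theorem IsEdge.le {n : ℕ} {P : Finset (Finset ℕ)} (hP : P ∈ partitions n) {i j : ℕ}
    (h : IsEdge P i j) : j ≤ n := by
  obtain ⟨-, B, hB, -, hj, -⟩ := h
  exact le_of_mem_block hP (Finset.mem_insert_of_mem hB) hj

/-- The set of linear crossings of `P`. -/
def crossings (P : Finset (Finset ℕ)) : Set ((ℕ × ℕ) × ℕ × ℕ) :=
  {e | IsEdge P e.1.1 e.1.2 ∧ IsEdge P e.2.1 e.2.2 ∧
    e.1.1 < e.2.1 ∧ e.2.1 < e.1.2 ∧ e.1.2 < e.2.2}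

theorem crol_eq_ncard (P : Finset (Finset ℕ)) : crol P = (crossings P).ncard := rfl

/-- The set of edges of `P` passing over `m`. -/
def edgesOver (P : Finset (Finset ℕ)) (m : ℕ) : Set (ℕ × ℕ) :=
  {e | IsEdge P e.1 e.2 ∧ e.1 < m ∧ m < e.2}

theorem crossings_finite {n : ℕ} {P : Finset (Finset ℕ)} (hP : P ∈ partitions n) :
    (crossings P).Finite := by
  refine ((((Set.finite_Iic n).prod (Set.finite_Iic n))).prod
    ((Set.finite_Iic n).prod (Set.finite_Iic n))).subset ?_
  rintro ⟨⟨a, b⟩, c, d⟩ ⟨h1, h2, h3, h4, h5⟩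
  have := h2.le hP
  simp only [Set.mem_prod, Set.mem_Iic] at *
  omega

theorem edgesOver_finite {n : ℕ} {P : Finset (Finset ℕ)} (hP : P ∈ partitions n) (m : ℕ) :
    (edgesOver P m).Finite := by
  refine ((Set.finite_Iic n).prod (Set.finite_Iic n)).subset ?_
  rintro ⟨a, b⟩ ⟨h1, h2, h3⟩
  have := h1.le hP
  simp only [Set.mem_prod, Set.mem_Iic] at *
  omega

theorem crol_extendBlock_empty {n : ℕ} {P : Finset (Finset ℕ)} (hP : P ∈ partitions n) :
    crol (extendBlock n P ∅) = crol P := by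
  have : ∀ i j, IsEdge (extendBlock n P ∅) i j ↔ IsEdge P i j := fun i j => by
    simp [isEdge_extendBlock hP (Finset.mem_insert_self _ _)]
  simp only [crol, this]

theorem crol_extendBlock {n : ℕ} {P : Finset (Finset ℕ)} (hP : P ∈ partitions n)
    {D : Finset ℕ} (hD : D ∈ P) {m : ℕ} (hm : m ∈ D) (hmax : ∀ p ∈ D, p ≤ m) :
    crol (extendBlock n P D) = crol P + (edgesOver P m).ncard := by
  have hE : ∀ i j, IsEdge (extendBlock n P D) i j ↔ IsEdge P i j ∨ i = m ∧ j = n + 1 := by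
    intro i j
    rw [isEdge_extendBlock hP (Finset.mem_insert_of_mem hD)]
    refine or_congr_right ⟨fun ⟨h1, h2, h3⟩ => ⟨le_antisymm (hmax i h2) (h3 m hm), h1⟩, ?_⟩
    rintro ⟨rfl, rfl⟩
    exact ⟨rfl, hm, hmax⟩
  have hset : crossings (extendBlock n P D) =
      crossings P ∪ (fun e : ℕ × ℕ => (e, (m, n + 1))) '' edgesOver P m := by
    ext ⟨⟨a, b⟩, c, d⟩
    simp only [crossings, edgesOver, hE, Set.mem_union, Set.mem_ofPred_eq, Set.mem_image,
      Prod.mk.injEq, Prod.exists]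
    constructor
    · rintro ⟨h1 | ⟨rfl, rfl⟩, h2 | ⟨rfl, rfl⟩, h3, h4, h5⟩
      · exact Or.inl ⟨h1, h2, h3, h4, h5⟩
      · exact Or.inr ⟨a, b, ⟨h1, h3, h4⟩, ⟨rfl, rfl⟩, rfl, rfl⟩
      · have := h2.le hP
        omega
      · omega
    · rintro (⟨h1, h2, h3, h4, h5⟩ | ⟨_, _, ⟨h1, h3, h4⟩, ⟨rfl, rfl⟩, rfl, rfl⟩)
      · exact ⟨Or.inl h1, Or.inl h2, h3, h4, h5⟩
      · have := h1.le hP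
        exact ⟨Or.inl h1, Or.inr ⟨rfl, rfl⟩, h3, h4, by omega⟩
  rw [crol_eq_ncard, crol_eq_ncard, hset, Set.ncard_union_eq ?_ (crossings_finite hP)
    ((edgesOver_finite hP m).image _), Set.ncard_image_of_injective]
  · intro e e' h
    exact (Prod.mk.inj h).1
  · rw [Set.disjoint_left]
    rintro _ ⟨-, h2, -⟩ ⟨e, -, rfl⟩
    have := h2.le hP
    simp at this

theorem ncard_edgesOver {n : ℕ} {P : Finset (Finset ℕ)} (hP : P ∈ partitions n)
    {D : Finset ℕ} (hD : D ∈ P) {m : ℕ} (hm : m ∈ D) (hmax : ∀ p ∈ D, p ≤ m) :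
    (edgesOver P m).ncard =
      (P.filter fun C => (∃ c ∈ C, c < m) ∧ ∃ c ∈ C, m < c).card := by
  obtain ⟨-, h1, -⟩ := mem_partitions_iff.1 hP
  rw [← Set.ncard_coe_finset]
  have hblock : ∀ e ∈ edgesOver P m, ∃ B ∈ P, e.1 ∈ B ∧ e.2 ∈ B ∧
      ∀ p ∈ B, ¬(e.1 < p ∧ p < e.2) := fun e he => he.1.2
  choose f hfP hf1 hf2 hf3 using hblock
  refine Set.ncard_congr f ?_ ?_ ?_
  · intro e he
    simp only [Finset.coe_filter, Set.mem_ofPred_eq]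
    exact ⟨hfP e he, ⟨e.1, hf1 e he, he.2.1⟩, e.2, hf2 e he, he.2.2⟩
  · intro e e' he he' h
    have a1 := hf3 e he e'.1 (h ▸ hf1 e' he')
    have a2 := hf3 e he e'.2 (h ▸ hf2 e' he')
    have a3 := hf3 e' he' e.1 (h ▸ hf1 e he)
    have a4 := hf3 e' he' e.2 (h ▸ hf2 e he)
    obtain ⟨-, b1, b2⟩ := he
    obtain ⟨-, b3, b4⟩ := he'
    exact Prod.ext (by omega) (by omega)
  · intro C hC
    simp only [Finset.coe_filter, Set.mem_ofPred_eq] at hC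
    obtain ⟨hCP, ⟨c, hc, hcm⟩, c', hc', hcm'⟩ := hC
    have hmC : m ∉ C := fun h => by
      rw [h1 D hD C hCP m hm h] at hmax
      have := hmax c' hc'
      omega
    obtain ⟨i, hi, himax⟩ := Finset.exists_max_image (C.filter (· < m)) id
      ⟨c, Finset.mem_filter.2 ⟨hc, hcm⟩⟩
    obtain ⟨j, hj, hjmin⟩ := Finset.exists_min_image (C.filter (m < ·)) id
      ⟨c', Finset.mem_filter.2 ⟨hc', hcm'⟩⟩
    rw [Finset.mem_filter] at hi hj
    have he : (i, j) ∈ edgesOver P m := by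
      refine ⟨⟨hi.2.trans hj.2, C, hCP, hi.1, hj.1, fun p hp h => ?_⟩, hi.2, hj.2⟩
      rcases lt_trichotomy p m with hpm | rfl | hpm
      · exact absurd (himax p (Finset.mem_filter.2 ⟨hp, hpm⟩)) (not_le.2 h.1)
      · exact hmC hp
      · exact absurd (hjmin p (Finset.mem_filter.2 ⟨hp, hpm⟩)) (not_le.2 h.2)
    exact ⟨(i, j), he, h1 _ (hfP _ he) C hCP i (hf1 _ he) hi.1⟩

theorem sum_lt_of_injOn {α : Type*} (s : Finset α) (M : α → ℕ) (hM : Set.InjOn M s) :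
    ∑ a ∈ s, ∑ b ∈ s, (if M a < M b then 1 else 0 : ℚ) = s.card * (s.card - 1) / 2 := by
  have h : ∑ a ∈ s, ∑ b ∈ s, ((if M a < M b then 1 else 0 : ℚ) +
      (if M b < M a then 1 else 0 : ℚ)) = s.card * (s.card - 1) := by
    have : ∀ a ∈ s, ∑ b ∈ s, ((if M a < M b then 1 else 0 : ℚ) +
        (if M b < M a then 1 else 0 : ℚ)) = s.card - 1 := by
      intro a ha
      have : ∀ b ∈ s, ((if M a < M b then 1 else 0 : ℚ) +
          (if M b < M a then 1 else 0 : ℚ)) = 1 - if a = b then 1 else 0 := by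
        intro b hb
        rcases lt_trichotomy (M a) (M b) with h | h | h
        · have : a ≠ b := by rintro rfl; omega
          simp [h, this, h.not_gt]
        · simp [hM ha hb h]
        · have : a ≠ b := by rintro rfl; omega
          simp [h, this, h.not_gt]
      rw [Finset.sum_congr rfl this, Finset.sum_sub_distrib]
      simp [ha]
    rw [Finset.sum_congr rfl this, Finset.sum_const, nsmul_eq_mul]
  simp only [Finset.sum_add_distrib] at h
  rw [Finset.sum_comm (f := fun a b => (if M b < M a then 1 else 0 : ℚ))] at h
  linarith

theorem sum_crol_extendBlock {n : ℕ} {P : Finset (Finset ℕ)} (hP : P ∈ partitions n) :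
    ∑ D ∈ P, (crol (extendBlock n P D) : ℚ) =
      P.card * crol P + P.card * (P.card - 1) / 2 - precedingPairs P := by
  obtain ⟨-, h1, -⟩ := mem_partitions_iff.1 hP
  have hM : ∀ D ∈ P, D.sup id ∈ D ∧ ∀ p ∈ D, p ≤ D.sup id := by
    intro D hD
    obtain ⟨m, hm, h⟩ := Finset.exists_mem_eq_sup D (nonempty_of_mem_partition hP hD) id
    exact ⟨h ▸ hm, fun p hp => Finset.le_sup (f := id) hp⟩
  have hinj : Set.InjOn (fun D : Finset ℕ => D.sup id) P := by
    intro B hB C hC h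
    exact h1 B hB C hC _ (hM B hB).1 (by simpa only [h] using (hM C hC).1)
  have hD : ∀ D ∈ P, (crol (extendBlock n P D) : ℚ) = crol P +
      ∑ C ∈ P, ((if D.sup id < C.sup id then 1 else 0) - precedes D C) := by
    intro D hD
    obtain ⟨hm, hmax⟩ := hM D hD
    rw [crol_extendBlock hP hD hm hmax, ncard_edgesOver hP hD hm hmax, Nat.cast_add,
      Finset.card_filter, Nat.cast_sum]
    congr 1
    refine Finset.sum_congr rfl fun C hC => ?_
    obtain ⟨hCm, hCmax⟩ := hM C hC
    have e1 : (∃ c ∈ C, D.sup id < c) ↔ D.sup id < C.sup id :=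
      ⟨fun ⟨c, hc, h⟩ => h.trans_le (hCmax c hc), fun h => ⟨_, hCm, h⟩⟩
    have e2 : (∀ b ∈ D, ∀ c ∈ C, b < c) ↔
        D.sup id < C.sup id ∧ ¬ ∃ c ∈ C, c < D.sup id := by
      constructor
      · intro h
        refine ⟨h _ hm _ hCm, ?_⟩
        rintro ⟨c, hc, hlt⟩
        have := h _ hm c hc
        omega
      · rintro ⟨hlt, h⟩ b hb c hc
        push Not at h
        have hb' := hmax b hb
        have hc' := h c hc
        rcases Nat.lt_or_ge b c with hbc | hbc
        · exact hbc
        · have hceq : D.sup id = c := by omega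
          have := h1 D hD C hC c (hceq ▸ hm) hc
          subst this
          omega
    simp only [precedes, e1, e2]
    by_cases a : D.sup id < C.sup id <;> by_cases b : ∃ c ∈ C, c < D.sup id <;>
      simp only [a, b] <;> simp
  rw [Finset.sum_congr rfl hD]
  simp only [Finset.sum_add_distrib, Finset.sum_sub_distrib, Finset.sum_const, nsmul_eq_mul]
  rw [sum_lt_of_injOn P _ hinj, precedingPairs]
  ring

theorem partitions_zero : partitions 0 = {∅} := by
  ext P
  rw [mem_partitions_iff, Finset.mem_singleton]
  constructor
  · rintro ⟨h0, -, h2⟩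
    rw [Finset.eq_empty_iff_forall_notMem]
    intro B hB
    obtain ⟨x, hx⟩ := Finset.nonempty_iff_ne_empty.2 fun h : B = ∅ => h0 (h ▸ hB)
    have := (h2 x).1 ⟨B, hB, hx⟩
    omega
  · rintro rfl
    simp
    omega

theorem sum_card_partitions_succ (n : ℕ) (f : ℕ → ℚ) :
    ∑ P ∈ partitions (n + 1), f P.card =
      ∑ P ∈ partitions n, (f (P.card + 1) + P.card * f P.card) := by
  rw [sum_partitions_succ]
  refine Finset.sum_congr rfl fun P hP => ?_
  rw [card_extendBlock_empty hP, Finset.sum_congr rfl fun D hD => by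
    rw [card_extendBlock hP hD], Finset.sum_const, nsmul_eq_mul]

theorem sum_precedingPairs_mul (n : ℕ) (f : ℕ → ℚ) :
    ∑ P ∈ partitions n, precedingPairs P * f P.card =
      ∑ P ∈ partitions n, ((n : ℚ) - P.card) * f (P.card + 1) := by
  induction n generalizing f with
  | zero => simp [partitions_zero, precedingPairs]
  | succ n ih =>
    have step : ∀ P ∈ partitions n,
        precedingPairs (extendBlock n P ∅) * f (extendBlock n P ∅).card +
          ∑ D ∈ P, precedingPairs (extendBlock n P D) * f (extendBlock n P D).card =
        precedingPairs P * (f (P.card + 1) + ((P.card : ℚ) - 1) * f P.card) +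
          P.card * f (P.card + 1) := by
      intro P hP
      rw [precedingPairs_extendBlock_empty hP, card_extendBlock_empty hP,
        Finset.sum_congr rfl fun D hD => by rw [card_extendBlock hP hD],
        ← Finset.sum_mul, sum_precedingPairs_extendBlock hP]
      ring
    rw [sum_partitions_succ, Finset.sum_congr rfl step, Finset.sum_add_distrib,
      ih fun k => f (k + 1) + ((k : ℚ) - 1) * f k,
      sum_card_partitions_succ n fun k => (((n + 1 : ℕ) : ℚ) - k) * f (k + 1),
      ← Finset.sum_add_distrib]
    refine Finset.sum_congr rfl fun P _ => ?_
    push_cast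
    ring

theorem sum_crol_mul (n : ℕ) (f : ℕ → ℚ) :
    ∑ P ∈ partitions n, (crol P : ℚ) * f P.card =
      ∑ P ∈ partitions n,
        (3 / 2 * (((n : ℚ) - P.card) * f (P.card + 1) +
            ((n : ℚ) + 1 - P.card) * P.card * f P.card) -
          (3 / 4 * P.card * (P.card + 1) + ((P.card : ℚ) + 1 / 2) * (n - P.card)) *
            f P.card) := by
  induction n generalizing f with
  | zero => simp [partitions_zero, crol, IsEdge]
  | succ n ih =>
    have step : ∀ P ∈ partitions n,
        (crol (extendBlock n P ∅) : ℚ) * f (extendBlock n P ∅).card +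
          ∑ D ∈ P, (crol (extendBlock n P D) : ℚ) * f (extendBlock n P D).card =
        crol P * (f (P.card + 1) + (P.card : ℚ) * f P.card) +
          P.card * (P.card - 1) / 2 * f P.card - precedingPairs P * f P.card := by
      intro P hP
      rw [crol_extendBlock_empty hP, card_extendBlock_empty hP,
        Finset.sum_congr rfl fun D hD => by rw [card_extendBlock hP hD],
        ← Finset.sum_mul, sum_crol_extendBlock hP]
      ring
    rw [sum_partitions_succ, Finset.sum_congr rfl step, Finset.sum_sub_distrib,
      Finset.sum_add_distrib, ih fun k => f (k + 1) + (k : ℚ) * f k, sum_precedingPairs_mul,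
      sum_card_partitions_succ n fun k => 3 / 2 * ((((n + 1 : ℕ) : ℚ) - k) * f (k + 1) +
            (((n + 1 : ℕ) : ℚ) + 1 - k) * k * f k) -
          (3 / 4 * k * (k + 1) + ((k : ℚ) + 1 / 2) * ((n + 1 : ℕ) - k)) * f k,
      ← Finset.sum_add_distrib, ← Finset.sum_sub_distrib]
    refine Finset.sum_congr rfl fun P _ => ?_
    push_cast
    ring

theorem bell_eq_sum (n : ℕ) : (bell n : ℚ) = ∑ _P ∈ partitions n, (1 : ℚ) := by
  simp [bell]

theorem bell_succ_eq_sum (n : ℕ) :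
    (bell (n + 1) : ℚ) = ∑ P ∈ partitions n, (1 + (P.card : ℚ)) := by
  rw [bell_eq_sum, sum_card_partitions_succ n fun _ => 1]
  simp

theorem bell_add_two_eq_sum (n : ℕ) :
    (bell (n + 2) : ℚ) =
      ∑ P ∈ partitions n, (2 + 2 * (P.card : ℚ) + (P.card : ℚ) ^ 2) := by
  rw [bell_succ_eq_sum, sum_card_partitions_succ n fun k => 1 + (k : ℚ)]
  refine Finset.sum_congr rfl fun P _ => ?_
  push_cast
  ring

theorem bell_pos (n : ℕ) : 0 < bell n := by
  induction n with
  | zero => simp [bell, partitions_zero]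
  | succ n ih =>
    obtain ⟨P, hP⟩ := Finset.card_pos.1 ih
    exact Finset.card_pos.2 ⟨_, extendBlock_mem hP (Finset.mem_insert_self _ _)⟩

theorem sum_crol (n : ℕ) :
    (∑ P ∈ partitions n, (crol P : ℚ)) =
      -(5/4) * (bell (n+2) : ℚ) + ((n : ℚ)/2 + 9/4) * (bell (n+1) : ℚ)
        + ((n : ℚ)/2 + 1/4) * (bell n : ℚ) := by
  have h := sum_crol_mul n fun _ => 1
  simp only [mul_one] at h
  rw [h, bell_add_two_eq_sum, bell_succ_eq_sum, bell_eq_sum, Finset.mul_sum, Finset.mul_sum,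
    Finset.mul_sum, ← Finset.sum_add_distrib, ← Finset.sum_add_distrib]
  refine Finset.sum_congr rfl fun P _ => ?_
  ring

/-- exact total and average number of linear crossings over `Π_n`. -/
theorem crol_mean_over_partitions (n : ℕ) (hn : 1 ≤ n) :
    (∑ π ∈ partitions n, (crol π : ℚ))
        = -(5/4) * (bell (n+2) : ℚ) + ((n : ℚ)/2 + 9/4) * (bell (n+1) : ℚ)
            + ((n : ℚ)/2 + 1/4) * (bell n : ℚ) ∧
    (∑ π ∈ partitions n, (crol π : ℚ)) / (bell n : ℚ)
        = -(5/4) * ((bell (n+2) : ℚ) / (bell n : ℚ))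
            + ((n : ℚ)/2 + 9/4) * ((bell (n+1) : ℚ) / (bell n : ℚ))
            + ((n : ℚ)/2 + 1/4) := by
  have hb : (bell n : ℚ) ≠ 0 := Nat.cast_ne_zero.2 (bell_pos n).ne'
  refine ⟨sum_crol n, ?_⟩
  rw [sum_crol n]
  field_simp
end
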